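/- arXiv:2203.12938 — 3 statements merged into one kernel-verified Lean document; each statement's English description precedes it below -/
import Mathlib

section
/- Let a ∈ ℝ, m₁, m₂, f ∈ ℝ, Z̃₁ = (0,a), Z̃₂ = (0,−a), Z₁ = (0,a,−1)/√(1+a²), Z₂ = (0,−a,−1)/√(1+a²), Z₀ = (0,0,−1), and m̂ᵢ = √(1+a²)·mᵢ. Suppose q̃ : I → ℝ² \ {Z̃₁, Z̃₂} is a C² curve satisfying the planar Lagrange equation d²q̃/dt² = −m₁‖q̃−Z̃₁‖_a^{−3}(q̃−Z̃₁) − m₂‖q̃−Z̃₂‖_a^{−3}(q̃−Z̃₂) + 2f·q̃. Let τ ↦ t(τ) solve dt/dτ = x̃(t)² + ỹ(t)² + 1 and set q(τ) := π(q̃(t(τ))). Then for every τ, q''(τ) − ⟨q''(τ), q(τ)⟩ q(τ) = m̂₁(1−⟨q,Z₁⟩²)^{−3/2}(Z₁ − ⟨q,Z₁⟩q) + m̂₂(1−⟨q,Z₂⟩²)^{−3/2}(Z₂ − ⟨q,Z₂⟩q) − 2f⟨q,Z₀⟩^{−3}(Z₀ − ⟨q,Z₀⟩q); i.e., the central projection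 carries solutions of the planar Lagrange problem (superposition of two Kepler problems and a Hooke problem centered at the midpoint) to solutions of the spherical Lagrange problem with force function m̂₁ cot θ_{Z₁} + m̂₂ cot θ_{Z₂} + f tan² θ_{Z₀}. -/
noncomputable section

/-- The affine norm `‖(x,y)‖ₐ = √(x² + y²/(1+a²))` on the plane. -/
def normA (a : ℝ) (p : ℝ × ℝ) : ℝ := Real.sqrt (p.1 ^ 2 + p.2 ^ 2 / (1 + a ^ 2))

/-- Central projection from the plane `{z = -1}` (identified with `ℝ²`) onto the
open southern hemisphere of the unit sphere in `ℝ³`. -/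
def centralProj (p : ℝ × ℝ) : ℝ × ℝ × ℝ :=
  (Real.sqrt (p.1 ^ 2 + p.2 ^ 2 + 1))⁻¹ • (p.1, p.2, (-1 : ℝ))

/-- The Euclidean dot product on `ℝ³ = ℝ × ℝ × ℝ`. -/
def dot3 (u v : ℝ × ℝ × ℝ) : ℝ := u.1 * v.1 + u.2.1 * v.2.1 + u.2.2 * v.2.2

/-- One-dimensional chain rule step for the projected coordinates. -/
theorem coord_step (x u R S : ℝ → ℝ) (s : ℝ) (hx : HasDerivAt x (u s) s)
    (hR : HasDerivAt R (S s) s) (h0 : R s ≠ 0) (t : ℝ → ℝ) (τ : ℝ) (hs : t τ = s)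
    (ht : HasDerivAt t (R s ^ 2) τ) :
    HasDerivAt (fun τ => (R (t τ))⁻¹ * x (t τ)) (R (t τ) * u (t τ) - S (t τ) * x (t τ)) τ := by
  subst hs
  have h := ((hR.inv h0).mul hx).comp τ ht
  refine HasDerivAt.congr_deriv (f := fun τ => (R (t τ))⁻¹ * x (t τ)) h ?_
  simp only [Pi.inv_apply]
  field_simp
  ring

/-- Second chain rule step. -/
theorem coord_step2 (x u R S : ℝ → ℝ) (s c r : ℝ) (hx : HasDerivAt x (u s) s)
    (hu : HasDerivAt u c s)
    (hR : HasDerivAt R (S s) s) (hS : HasDerivAt S r s) (t : ℝ → ℝ) (τ : ℝ) (hs : t τ = s)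
    (ht : HasDerivAt t (R s ^ 2) τ) :
    HasDerivAt (fun τ => R (t τ) * u (t τ) - S (t τ) * x (t τ))
      (R s ^ 2 * (R s * c - r * x s)) τ := by
  subst hs
  have h := ((hR.mul hu).sub (hS.mul hx)).comp τ ht
  refine HasDerivAt.congr_deriv
    (f := fun τ => R (t τ) * u (t τ) - S (t τ) * x (t τ)) h ?_
  ring

/-- The spherical Kepler coefficient in planar terms. -/
theorem kepler_coef (a b m x y R : ℝ) (hb : b ^ 2 = a ^ 2) (hR : 0 < R)
    (hR2 : R ^ 2 = x ^ 2 + y ^ 2 + 1) (q Z : ℝ × ℝ × ℝ) (hq : q = R⁻¹ • (x, y, (-1 : ℝ)))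
    (hZ : Z = (Real.sqrt (1 + a ^ 2))⁻¹ • ((0 : ℝ), b, (-1 : ℝ))) :
    (Real.sqrt (1 + a ^ 2) * m * (1 - dot3 q Z ^ 2) ^ (-(3 : ℝ) / 2)) • (Z - dot3 q Z • q)
      = (m / (normA a ((x, y) - (0, b))) ^ 3 * R ^ 3) •
        (((0 : ℝ), b, (-1 : ℝ)) - dot3 q ((0 : ℝ), b, (-1 : ℝ)) • q) := by
  have ha : 0 < 1 + a ^ 2 := by positivity
  set w := Real.sqrt (1 + a ^ 2) with hw
  have hw0 : 0 < w := Real.sqrt_pos.mpr ha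
  have hw2 : w ^ 2 = 1 + a ^ 2 := Real.sq_sqrt ha.le
  set n := normA a ((x, y) - (0, b)) with hn
  have hn0 : 0 ≤ n := Real.sqrt_nonneg _
  have hn2 : n ^ 2 = x ^ 2 + (y - b) ^ 2 / (1 + a ^ 2) := by
    rw [hn, normA, Real.sq_sqrt (by positivity)]
    simp
  have hd : dot3 q Z = R⁻¹ * w⁻¹ * (b * y + 1) := by
    subst hq hZ
    simp [dot3]
    ring
  have h1 : 1 - dot3 q Z ^ 2 = (n / R) ^ 2 := by
    rw [hd, div_pow, hn2, mul_pow, mul_pow, inv_pow, inv_pow, hw2, hR2]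
    have : x ^ 2 + y ^ 2 + 1 ≠ 0 := by positivity
    field_simp
    linear_combination (-y ^ 2 - 1) * hb
  have h2 : (1 - dot3 q Z ^ 2) ^ (-(3 : ℝ) / 2) = R ^ 3 / n ^ 3 := by
    rw [h1, ← Real.rpow_natCast (n / R) 2, ← Real.rpow_mul (by positivity)]
    rw [show ((2 : ℕ) : ℝ) * (-(3 : ℝ) / 2) = -((3 : ℕ) : ℝ) by norm_num,
      Real.rpow_neg (by positivity), Real.rpow_natCast, div_pow, inv_div]
  have hZ' : Z - dot3 q Z • q
      = w⁻¹ • (((0 : ℝ), b, (-1 : ℝ)) - dot3 q ((0 : ℝ), b, (-1 : ℝ)) • q) := by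
    subst hZ
    ext <;> simp [dot3] <;> ring
  rw [h2, hZ', smul_smul]
  congr 1
  field_simp

/-- The central projection carries solutions of the planar Lagrange problem
(superposition of two Kepler problems and a Hooke problem centered at the
midpoint of the Kepler centers) to solutions of the spherical Lagrange problem
with force function `m̂₁ cot θ_{Z₁} + m̂₂ cot θ_{Z₂} + f tan² θ_{Z₀}`. -/
theorem lagrange_central_projection_sphere
    (a m₁ m₂ f mhat₁ mhat₂ : ℝ)
    (hm₁ : mhat₁ = Real.sqrt (1 + a ^ 2) * m₁)
    (hm₂ : mhat₂ = Real.sqrt (1 + a ^ 2) * m₂)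
    (Zt₁ Zt₂ : ℝ × ℝ) (hZt₁ : Zt₁ = (0, a)) (hZt₂ : Zt₂ = (0, -a))
    (Z₁ Z₂ Z0 : ℝ × ℝ × ℝ)
    (hZ₁ : Z₁ = (Real.sqrt (1 + a ^ 2))⁻¹ • ((0 : ℝ), a, (-1 : ℝ)))
    (hZ₂ : Z₂ = (Real.sqrt (1 + a ^ 2))⁻¹ • ((0 : ℝ), -a, (-1 : ℝ)))
    (hZ0 : Z0 = ((0 : ℝ), (0 : ℝ), (-1 : ℝ)))
    (qt : ℝ → ℝ × ℝ) (hne₁ : ∀ s, qt s ≠ Zt₁) (hne₂ : ∀ s, qt s ≠ Zt₂)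
    (hC2 : ContDiff ℝ 2 qt)
    (hODE : ∀ s, deriv (deriv qt) s
        = -(m₁ / (normA a (qt s - Zt₁)) ^ 3) • (qt s - Zt₁)
          - (m₂ / (normA a (qt s - Zt₂)) ^ 3) • (qt s - Zt₂)
          + (2 * f) • qt s)
    (t : ℝ → ℝ)
    (ht : ∀ τ, HasDerivAt t ((qt (t τ)).1 ^ 2 + (qt (t τ)).2 ^ 2 + 1) τ)
    (q : ℝ → ℝ × ℝ × ℝ) (hq : q = fun τ => centralProj (qt (t τ))) :
    ∀ τ, deriv (deriv q) τ - dot3 (deriv (deriv q) τ) (q τ) • q τ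
      = (mhat₁ * (1 - dot3 (q τ) Z₁ ^ 2) ^ (-(3 : ℝ) / 2)) •
          (Z₁ - dot3 (q τ) Z₁ • q τ)
        + (mhat₂ * (1 - dot3 (q τ) Z₂ ^ 2) ^ (-(3 : ℝ) / 2)) •
          (Z₂ - dot3 (q τ) Z₂ • q τ)
        - (2 * f / (dot3 (q τ) Z0) ^ 3) • (Z0 - dot3 (q τ) Z0 • q τ) := by
  subst hm₁ hm₂ hZt₁ hZt₂ hZ0
  set x : ℝ → ℝ := fun s => (qt s).1 with hxdef
  set y : ℝ → ℝ := fun s => (qt s).2 with hydef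
  set u : ℝ → ℝ := fun s => (deriv qt s).1 with hudef
  set v : ℝ → ℝ := fun s => (deriv qt s).2 with hvdef
  have hqt : ∀ s, HasDerivAt qt (deriv qt s) s := fun s =>
    ((hC2.differentiable (by norm_num)) s).hasDerivAt
  have hC1 : ContDiff ℝ 1 (deriv qt) := by
    have : ContDiff ℝ (1 + 1) qt := by
      norm_num
      exact hC2
    exact (contDiff_succ_iff_deriv.mp this).2.2
  have hqt2 : ∀ s, HasDerivAt (deriv qt) (deriv (deriv qt) s) s := fun s =>
    ((hC1.differentiable (by norm_num)) s).hasDerivAt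
  have hx : ∀ s, HasDerivAt x (u s) s := fun s => (hqt s).fst
  have hy : ∀ s, HasDerivAt y (v s) s := fun s => (hqt s).snd
  have hu : ∀ s, HasDerivAt u (deriv (deriv qt) s).1 s := fun s => (hqt2 s).fst
  have hv : ∀ s, HasDerivAt v (deriv (deriv qt) s).2 s := fun s => (hqt2 s).snd
  let R : ℝ → ℝ := fun s => Real.sqrt (x s ^ 2 + y s ^ 2 + 1)
  let S : ℝ → ℝ := fun s => (x s * u s + y s * v s) / R s
  have hRpos : ∀ s, 0 < R s := fun s => Real.sqrt_pos.mpr (by positivity)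
  have hR2 : ∀ s, R s ^ 2 = x s ^ 2 + y s ^ 2 + 1 := fun s => Real.sq_sqrt (by positivity)
  have hR : ∀ s, HasDerivAt R (S s) s := by
    intro s
    have h := ((((hx s).pow 2).add ((hy s).pow 2)).add_const 1).sqrt
      (show x s ^ 2 + y s ^ 2 + 1 ≠ 0 by positivity)
    refine HasDerivAt.congr_deriv (f := R) h ?_
    change _ / (2 * R s) = (x s * u s + y s * v s) / R s
    have := (hRpos s).ne'
    field_simp
    simp
    ring
  have hS : ∀ s, ∃ r, HasDerivAt S r s := fun s =>
    ⟨_, (((hx s).mul (hu s)).add ((hy s).mul (hv s))).div (hR s) (hRpos s).ne'⟩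
  have ht' : ∀ τ, HasDerivAt t (R (t τ) ^ 2) τ := fun τ => by
    rw [hR2]; exact ht τ
  have hqv : ∀ τ, q τ = (R (t τ))⁻¹ • (x (t τ), y (t τ), (-1 : ℝ)) := fun τ => by
    rw [hq]; rfl
  have hq1 : deriv q = fun τ => (R (t τ) * u (t τ) - S (t τ) * x (t τ),
      R (t τ) * v (t τ) - S (t τ) * y (t τ),
      R (t τ) * (fun _ => (0 : ℝ)) (t τ) - S (t τ) * (fun _ => (-1 : ℝ)) (t τ)) := by
    funext τ
    have h := (coord_step x u R S _ (hx _) (hR _) (hRpos _).ne' t τ rfl (ht' τ)).prodMk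
      ((coord_step y v R S _ (hy _) (hR _) (hRpos _).ne' t τ rfl (ht' τ)).prodMk
      (coord_step (fun _ => (-1 : ℝ)) (fun _ => (0 : ℝ)) R S _ (hasDerivAt_const _ _)
        (hR _) (hRpos _).ne' t τ rfl (ht' τ)))
    have hqe : q = fun τ => ((R (t τ))⁻¹ * x (t τ), (R (t τ))⁻¹ * y (t τ),
        (R (t τ))⁻¹ * (fun _ => (-1 : ℝ)) (t τ)) := by
      funext τ
      rw [hqv τ]
      rfl
    rw [hqe]
    exact h.deriv
  intro τ
  obtain ⟨r, hr⟩ := hS (t τ)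
  have hq2 := ((coord_step2 x u R S _ _ r (hx _) (hu _) (hR _) hr t τ rfl (ht' τ)).prodMk
      ((coord_step2 y v R S _ _ r (hy _) (hv _) (hR _) hr t τ rfl (ht' τ)).prodMk
      (coord_step2 (fun _ => (-1 : ℝ)) (fun _ => (0 : ℝ)) R S _ _ r (hasDerivAt_const _ _)
        (hasDerivAt_const _ _) (hR _) hr t τ rfl (ht' τ)))).deriv
  rw [← hq1] at hq2
  rw [kepler_coef a a m₁ _ _ _ rfl (hRpos (t τ)) (hR2 _) _ Z₁ (hqv τ) hZ₁,
    kepler_coef a (-a) m₂ _ _ _ (by ring) (hRpos (t τ)) (hR2 _) _ Z₂ (hqv τ) hZ₂, hq2,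
    hODE (t τ)]
  have hz : dot3 (q τ) ((0 : ℝ), (0 : ℝ), (-1 : ℝ)) = (R (t τ))⁻¹ := by
    rw [hqv τ]
    simp [dot3]
  rw [hz, hqv τ]
  have e1 : qt (t τ) = (x (t τ), y (t τ)) := rfl
  rw [e1]
  generalize m₁ / normA a ((x (t τ), y (t τ)) - (0, a)) ^ 3 = K₁
  generalize m₂ / normA a ((x (t τ), y (t τ)) - (0, -a)) ^ 3 = K₂
  have hR2' := hR2 (t τ)
  have hR0 := (hRpos (t τ)).ne'
  generalize R (t τ) = ρ at *
  generalize x (t τ) = X at *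
  generalize y (t τ) = Y at *
  have hd : 2 * f / ρ⁻¹ ^ 3 = 2 * f * ρ ^ 3 := by
    field_simp
  rw [hd]
  have hi : ρ⁻¹ ^ 2 * (X ^ 2 + Y ^ 2 + 1) = 1 := by
    rw [← hR2']
    field_simp
  generalize ρ⁻¹ = i at *
  ext
  · simp [dot3]
    linear_combination (K₁ * ρ ^ 3 + K₂ * ρ ^ 3 - 2 * f * ρ ^ 3 + ρ ^ 2 * r) * X * hi
  · simp [dot3]
    linear_combination (K₁ * ρ ^ 3 + K₂ * ρ ^ 3 - 2 * f * ρ ^ 3 + ρ ^ 2 * r) * Y * hi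
  · simp [dot3]
    linear_combination -(K₁ * ρ ^ 3 + K₂ * ρ ^ 3 - 2 * f * ρ ^ 3 + ρ ^ 2 * r) * hi
end
end

section
/- Let 0 < α ≤ β < π/2, let γ = arccos(cos β / cos α) ∈ [0, π/2), and set Z₊ = (0, sin γ, −cos γ) and Z₋ = (0, −sin γ, −cos γ). Then for every q = (x,y,z) ∈ ℝ³ with x² + y² + z² = 1, z < 0, and x²/sin²α + y²/sin²β = 1, one has arccos⟨q, Z₊⟩ + arccos⟨q, Z₋⟩ = 2β. In other words, the spherical conic obtained by intersecting the elliptic cone x²/tan²α + y²/tan²β = z² with the open southern hemisphere is a spherical ellipse with foci Z₊ and Z₋, which are the central projections of the points (0, ±a, −1) with a = tan γ. -/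
noncomputable section

set_option maxHeartbeats 1000000 in
/-- The spherical conic cut out of the open southern hemisphere by the elliptic
cone `x²/tan²α + y²/tan²β = z²` is a spherical ellipse with foci
`Z₊ = (0, sin γ, -cos γ)` and `Z₋ = (0, -sin γ, -cos γ)`, where
`γ = arccos(cos β / cos α)`: the sum of spherical distances to `Z₊`, `Z₋` of any
of its points equals `2β`. Moreover `Z₊`, `Z₋` are the central projections of
`(0, ±a, -1)` with `a = tan γ`. -/
theorem spherical_ellipse_foci
    (α β : ℝ) (hα : 0 < α) (hαβ : α ≤ β) (hβ : β < Real.pi / 2)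
    (γ : ℝ) (hγ : γ = Real.arccos (Real.cos β / Real.cos α))
    (Zp Zm : ℝ × ℝ × ℝ)
    (hZp : Zp = ((0 : ℝ), Real.sin γ, -Real.cos γ))
    (hZm : Zm = ((0 : ℝ), -Real.sin γ, -Real.cos γ)) :
    (∀ x y z : ℝ, x ^ 2 + y ^ 2 + z ^ 2 = 1 → z < 0 →
        x ^ 2 / Real.sin α ^ 2 + y ^ 2 / Real.sin β ^ 2 = 1 →
        Real.arccos (dot3 (x, y, z) Zp) + Real.arccos (dot3 (x, y, z) Zm) = 2 * β)
      ∧ centralProj (0, Real.tan γ) = Zp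
      ∧ centralProj (0, -Real.tan γ) = Zm := by
  have hpi := Real.pi_pos
  have hca : 0 < Real.cos α := Real.cos_pos_of_mem_Ioo ⟨by linarith, by linarith⟩
  have hcb : 0 < Real.cos β := Real.cos_pos_of_mem_Ioo ⟨by linarith, by linarith⟩
  have hsa : 0 < Real.sin α := Real.sin_pos_of_pos_of_lt_pi hα (by linarith)
  have hsb : 0 < Real.sin β := Real.sin_pos_of_pos_of_lt_pi (by linarith) (by linarith)
  have hcab : Real.cos β ≤ Real.cos α :=
    Real.cos_le_cos_of_nonneg_of_le_pi hα.le (by linarith) hαβ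
  have hr0 : 0 < Real.cos β / Real.cos α := div_pos hcb hca
  have hr1 : Real.cos β / Real.cos α ≤ 1 := (div_le_one hca).2 hcab
  have hcg : Real.cos γ = Real.cos β / Real.cos α := by
    rw [hγ, Real.cos_arccos (by linarith) hr1]
  have hcg0 : 0 < Real.cos γ := by rw [hcg]; exact hr0
  have hcgb : Real.cos γ * Real.cos α = Real.cos β := by rw [hcg]; field_simp
  have hsg : 0 ≤ Real.sin γ := by
    rw [hγ]
    exact Real.sin_nonneg_of_nonneg_of_le_pi (Real.arccos_nonneg _) (Real.arccos_le_pi _)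
  have pa := Real.sin_sq_add_cos_sq α
  have pb := Real.sin_sq_add_cos_sq β
  have pg := Real.sin_sq_add_cos_sq γ
  have hsq : Real.sqrt (Real.tan γ ^ 2 + 1) = (Real.cos γ)⁻¹ := by
    rw [Real.sqrt_eq_iff_mul_self_eq (by positivity) (by positivity), Real.tan_eq_sin_div_cos]
    field_simp
    linarith
  refine ⟨?_, ?_, ?_⟩
  · intro x y z h1 hz h2
    have hcb_le : Real.cos β ≤ Real.cos γ := by
      nlinarith [Real.cos_le_one α]
    have hsgb : Real.sin γ ≤ Real.sin β := by
      refine abs_le_of_sq_le_sq ?_ hsb.le |> le_trans (le_abs_self _)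
      nlinarith
    have hx : x ^ 2 * Real.sin β ^ 2 + y ^ 2 * Real.sin α ^ 2
        = Real.sin α ^ 2 * Real.sin β ^ 2 := by
      field_simp at h2
      linarith
    have hy2 : y ^ 2 ≤ Real.sin β ^ 2 := by
      have : 0 ≤ x ^ 2 / Real.sin α ^ 2 := by positivity
      have h3 : y ^ 2 / Real.sin β ^ 2 ≤ 1 := by linarith
      rwa [div_le_one (by positivity)] at h3
    have hy := abs_le_of_sq_le_sq' hy2 hsb.le
    set s := y * Real.sin γ / Real.sin β with hs
    have hsm : s * Real.sin β = y * Real.sin γ := by rw [hs]; field_simp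
    have hs1 : s ≤ Real.sin β := by
      rw [hs, div_le_iff₀ hsb]; nlinarith
    have hs2 : -Real.sin β ≤ s := by
      rw [hs, le_div_iff₀ hsb]; nlinarith
    have hb1 := Real.sin_le_one β
    have hd1 : Real.arcsin s ≤ β :=
      (Real.arcsin_le_iff_le_sin' ⟨by linarith, by linarith⟩).2 hs1
    have hd2 : -β ≤ Real.arcsin s :=
      (Real.le_arcsin_iff_sin_le' ⟨by linarith, by linarith⟩).2 (by rw [Real.sin_neg]; exact hs2)
    have hsin : Real.sin (Real.arcsin s) = s := Real.sin_arcsin (by linarith) (by linarith)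
    have hkey : z ^ 2 * Real.sin β ^ 2 + (y * Real.sin γ) ^ 2 * Real.cos α ^ 2
        = Real.cos α ^ 2 * Real.sin β ^ 2 := by
      have e1 : Real.sin γ ^ 2 * Real.cos α ^ 2 = Real.cos α ^ 2 - Real.cos β ^ 2 := by
        rw [← hcgb]; linear_combination Real.cos α ^ 2 * pg
      linear_combination y ^ 2 * e1 + Real.sin β ^ 2 * h1 - hx - Real.sin β ^ 2 * pa
        + y ^ 2 * pa - y ^ 2 * pb
    have hcos : Real.cos (Real.arcsin s) = -z / Real.cos α := by
      rw [Real.cos_arcsin, Real.sqrt_eq_iff_mul_self_eq_of_pos (div_pos (by linarith) hca), hs]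
      field_simp
      linarith
    have hd : Real.cos β * Real.cos (Real.arcsin s) = -z * Real.cos γ := by
      rw [hcos, ← hcgb]; field_simp
    have A1 : dot3 (x, y, z) Zp = Real.cos (β - Real.arcsin s) := by
      rw [Real.cos_sub, hd, hsin, hZp]; simp only [dot3]; linarith
    have A2 : dot3 (x, y, z) Zm = Real.cos (β + Real.arcsin s) := by
      rw [Real.cos_add, hd, hsin, hZm]; simp only [dot3]; linarith
    rw [A1, A2, Real.arccos_cos (by linarith) (by linarith),
      Real.arccos_cos (by linarith) (by linarith)]
    ring
  · have : Real.cos γ * Real.tan γ = Real.sin γ := by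
      rw [Real.tan_eq_sin_div_cos]; field_simp
    rw [hZp]
    simp [centralProj, hsq, this]
  · have : Real.cos γ * Real.tan γ = Real.sin γ := by
      rw [Real.tan_eq_sin_div_cos]; field_simp
    rw [hZm]
    simp [centralProj, hsq, this]
end
end

section
/- Let α, β ∈ (0, π/2) and θ ∈ ℝ. Set D(θ) = √(1 − sin²α cos²θ − sin²β sin²θ) (which is positive), q̃(θ) = (sin α cos θ / D(θ), sin β sin θ / D(θ)), ŝ(θ) = (−sin α cos²β sin θ, sin β cos²α cos θ), and n̂(θ) = (sin β cos θ, sin α sin θ). Define the quadratic form Q(p, v) := (1 + p₂²)v₁² − 2p₁p₂v₁v₂ + (1 + p₁²)v₂² for p, v ∈ ℝ². Then for all k₁, k₂ ∈ ℝ: Q(q̃(θ), k₁ŝ(θ) + k₂n̂(θ)) = Q(q̃(θ), k₁ŝ(θ) − k₂n̂(θ)). Consequently, the spherical kinetic energy expressed in the gnomonic chart is invariant under the planar reflection at the projected confocal ellipse, which is the key invariance underlying the integrability of Lagrange billiards with confocal conic reflection walls. -/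
noncomputable section

/-- Twice the spherical kinetic energy in the gnomonic chart at the point `p`,
evaluated on the velocity `v`. -/
def Qform (p v : ℝ × ℝ) : ℝ :=
  (1 + p.2 ^ 2) * v.1 ^ 2 - 2 * p.1 * p.2 * v.1 * v.2 + (1 + p.1 ^ 2) * v.2 ^ 2

/-- The spherical kinetic energy expressed in the gnomonic chart is invariant
under the planar reflection at the projected confocal ellipse: with `q̃(θ)` the
projected point of the spherical ellipse, `ŝ(θ)` the projected tangent vector
and `n̂(θ)` the projected normal vector, `Q(q̃, k₁ŝ + k₂n̂) = Q(q̃, k₁ŝ − k₂n̂)`.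
Moreover, the quantity `D(θ)` defining the projection is positive. -/
theorem kinetic_form_invariant_under_reflection
    (α β : ℝ) (hα : α ∈ Set.Ioo 0 (Real.pi / 2)) (hβ : β ∈ Set.Ioo 0 (Real.pi / 2))
    (θ : ℝ)
    (D : ℝ)
    (hD : D = Real.sqrt (1 - Real.sin α ^ 2 * Real.cos θ ^ 2
        - Real.sin β ^ 2 * Real.sin θ ^ 2))
    (qt s n : ℝ × ℝ)
    (hqt : qt = (Real.sin α * Real.cos θ / D, Real.sin β * Real.sin θ / D))
    (hs : s = (-(Real.sin α * Real.cos β ^ 2 * Real.sin θ),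
        Real.sin β * Real.cos α ^ 2 * Real.cos θ))
    (hn : n = (Real.sin β * Real.cos θ, Real.sin α * Real.sin θ)) :
    0 < D ∧ ∀ k₁ k₂ : ℝ, Qform qt (k₁ • s + k₂ • n) = Qform qt (k₁ • s - k₂ • n) := by
  have hca : 0 < Real.cos α := Real.cos_pos_of_mem_Ioo ⟨by linarith [hα.1, Real.pi_pos], hα.2⟩
  have hcb : 0 < Real.cos β := Real.cos_pos_of_mem_Ioo ⟨by linarith [hβ.1, Real.pi_pos], hβ.2⟩
  have ha := Real.sin_sq_add_cos_sq α
  have hb := Real.sin_sq_add_cos_sq β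
  have ht := Real.sin_sq_add_cos_sq θ
  have hpos : 0 < 1 - Real.sin α ^ 2 * Real.cos θ ^ 2 - Real.sin β ^ 2 * Real.sin θ ^ 2 := by
    have e : 1 - Real.sin α ^ 2 * Real.cos θ ^ 2 - Real.sin β ^ 2 * Real.sin θ ^ 2
        = Real.cos α ^ 2 * Real.cos θ ^ 2 + Real.cos β ^ 2 * Real.sin θ ^ 2 := by
      linear_combination (-1) * ht - Real.cos θ ^ 2 * ha - Real.sin θ ^ 2 * hb + 0
    rw [e]
    rcases eq_or_ne (Real.cos θ) 0 with h | h
    · have h1 : Real.sin θ ^ 2 = 1 := by rw [h] at ht; linarith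
      rw [h, h1]; positivity
    · positivity
  have hDp : 0 < D := by rw [hD]; exact Real.sqrt_pos.mpr hpos
  refine ⟨hDp, fun k₁ k₂ => ?_⟩
  have hD2 : D ^ 2 = 1 - Real.sin α ^ 2 * Real.cos θ ^ 2 - Real.sin β ^ 2 * Real.sin θ ^ 2 := by
    rw [hD]; exact Real.sq_sqrt hpos.le
  clear hD
  subst hqt hs hn
  have hA : Real.cos α ^ 2 = 1 - Real.sin α ^ 2 := by linarith
  have hB : Real.cos β ^ 2 = 1 - Real.sin β ^ 2 := by linarith
  have hT : Real.cos θ ^ 2 = 1 - Real.sin θ ^ 2 := by linarith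
  simp only [Qform, Prod.fst_add, Prod.snd_add, Prod.fst_sub, Prod.snd_sub, Prod.smul_fst,
    Prod.smul_snd, smul_eq_mul, hA, hB]
  generalize Real.sin α = a at *
  generalize Real.sin β = b at *
  generalize Real.sin θ = s at *
  generalize Real.cos θ = c at *
  have key : (D ^ 2 + b ^ 2 * s ^ 2) * (-(a * (1 - b ^ 2) * s)) * (b * c)
      - a * c * (b * s) * (-(a * (1 - b ^ 2) * s) * (a * s) + b * (1 - a ^ 2) * c * (b * c))
      + (D ^ 2 + a ^ 2 * c ^ 2) * (b * (1 - a ^ 2) * c) * (a * s) = 0 := by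
    rw [hD2]
    linear_combination (a * b * c * s) * (a ^ 2 * (1 - b ^ 2) - b ^ 2 * (1 - a ^ 2)) * ht
  field_simp
  linear_combination 4 * k₁ * k₂ * key
end
end
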